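/- Let G be a finite group acting on a type M, with subgroups H₁, H₂ satisfying the Gassmann condition. Let V be any complex vector space with a linear G-action and φ : V → V a G-equivariant linear map. Then the restrictions of φ to the invariant subspaces V^{H₁} and V^{H₂} have the same characteristic polynomial (equivalently, are conjugate linear maps), provided V is finite dimensional. -/

import Mathlib

/-- A Gassmann triple gives a bijection between the subgroups preserving conjugacy classes. -/
lemma gassmann_equiv {G : Type} [Group G] [Fintype G] (H₁ H₂ : Subgroup G)
    (hGass : ∀ g : G, Nat.card {h : G // h ∈ H₁ ∧ IsConj g h}
                    = Nat.card {h : G // h ∈ H₂ ∧ IsConj g h}) :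
    ∃ e : H₁ ≃ H₂, ∀ h : H₁, IsConj (h : G) (e h : G) := by
  classical
  have key : ∀ (H : Subgroup G) (g : G),
      Nonempty ({h : H // ConjClasses.mk (h : G) = ConjClasses.mk g} ≃
        {h : G // h ∈ H ∧ IsConj g h}) := by
    intro H g
    exact ⟨{ toFun := fun h => ⟨h.1.1, h.1.2, (ConjClasses.mk_eq_mk_iff_isConj.1 h.2).symm⟩
             invFun := fun h => ⟨⟨h.1, h.2.1⟩, ConjClasses.mk_eq_mk_iff_isConj.2 h.2.2.symm⟩
             left_inv := fun _ => rfl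
             right_inv := fun _ => rfl }⟩
  have ex : ∀ c : ConjClasses G,
      Nonempty ({h : H₁ // ConjClasses.mk (h : G) = c} ≃
        {h : H₂ // ConjClasses.mk (h : G) = c}) := by
    intro c
    obtain ⟨g, rfl⟩ := ConjClasses.exists_rep c
    obtain ⟨a⟩ := key H₁ g
    obtain ⟨b⟩ := key H₂ g
    exact ⟨a.trans (((Finite.card_eq.1 (hGass g)).some).trans b.symm)⟩
  let e := Equiv.ofFiberEquiv (f := fun h : H₁ => ConjClasses.mk (h : G))
    (g := fun h : H₂ => ConjClasses.mk (h : G)) (fun c => (ex c).some)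
  refine ⟨e, fun h => ?_⟩
  have := Equiv.ofFiberEquiv_map (f := fun h : H₁ => ConjClasses.mk (h : G))
    (g := fun h : H₂ => ConjClasses.mk (h : G)) (fun c => (ex c).some) h
  exact (ConjClasses.mk_eq_mk_iff_isConj.1 this).symm

lemma gassmann_finrank {G : Type} [Group G] [Fintype G] (H₁ H₂ : Subgroup G)
    (e : H₁ ≃ H₂) (he : ∀ h : H₁, IsConj (h : G) (e h : G))
    {W : Type} [AddCommGroup W] [Module ℂ W] [FiniteDimensional ℂ W]
    (σ : Representation ℂ G W) :
    Module.finrank ℂ (Representation.invariants (σ.comp H₁.subtype : Representation ℂ H₁ W)) =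
    Module.finrank ℂ (Representation.invariants (σ.comp H₂.subtype : Representation ℂ H₂ W)) := by
  classical
  have : Invertible (Nat.card H₁ : ℂ) := invertibleOfNonzero (by exact_mod_cast Nat.card_pos.ne')
  have : Invertible (Nat.card H₂ : ℂ) := invertibleOfNonzero (by exact_mod_cast Nat.card_pos.ne')
  have a := Representation.card_inv_mul_sum_char_eq_finrank
    (σ.comp H₁.subtype : Representation ℂ H₁ W)
  have b := Representation.card_inv_mul_sum_char_eq_finrank
    (σ.comp H₂.subtype : Representation ℂ H₂ W)
  have s : ∑ g, Representation.character (σ.comp H₁.subtype : Representation ℂ H₁ W) g =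
      ∑ g, Representation.character (σ.comp H₂.subtype : Representation ℂ H₂ W) g := by
    refine Fintype.sum_equiv e _ _ fun h => ?_
    obtain ⟨c, hc⟩ := isConj_iff.1 (he h)
    have := σ.char_conj h c
    rw [hc] at this
    exact this.symm
  rw [s, Nat.card_congr e, b] at a
  exact_mod_cast a.symm

lemma rootMultiplicity_restrict_invariants {G : Type} [Group G] (H : Subgroup G)
    {V : Type} [AddCommGroup V] [Module ℂ V] [FiniteDimensional ℂ V]
    (ρ : Representation ℂ G V) (φ : V →ₗ[ℂ] V) (μ : ℂ)
    (le : ∀ g, Module.End.maxGenEigenspace φ μ ≤ (Module.End.maxGenEigenspace φ μ).comap (ρ g))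
    (h₁ : ∀ v ∈ Representation.invariants (ρ.comp H.subtype : Representation ℂ H V),
      φ v ∈ Representation.invariants (ρ.comp H.subtype : Representation ℂ H V)) :
    (LinearMap.charpoly (φ.restrict h₁)).rootMultiplicity μ =
    Module.finrank ℂ (Representation.invariants
      ((ρ.subrepresentation _ le).comp H.subtype : Representation ℂ H _)) := by
  rw [← LinearMap.finrank_maxGenEigenspace_eq, Module.End.maxGenEigenspace,
    Module.End.genEigenspace_restrict, ← Submodule.finrank_map_subtype_eq,
    ← Submodule.finrank_map_subtype_eq (Module.End.maxGenEigenspace φ μ)]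
  congr 2
  all_goals
    ext v
    simp only [Submodule.mem_map, Submodule.mem_comap, Representation.mem_invariants]
    constructor
    · rintro ⟨⟨w, hw⟩, hm, rfl⟩
      exact ⟨⟨w, hm⟩, fun h => Subtype.ext (hw h), rfl⟩
    · rintro ⟨⟨w, hw⟩, hm, rfl⟩
      exact ⟨⟨w, fun h => congrArg Subtype.val (hm h)⟩, hw, rfl⟩


/-- Let `G` be a finite group with subgroups `H₁, H₂` satisfying the Gassmann
condition. Let `V` be any finite-dimensional complex vector space with a linear `G`-action
(a representation `ρ`) and `φ : V → V` a `G`-equivariant linear map. Then the restrictions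
of `φ` to the invariant subspaces `V^{H₁}` and `V^{H₂}` (which are preserved by `φ`) have
the same characteristic polynomial. -/
theorem sunada_algebraic_core (G : Type) [Group G] [Fintype G] (H₁ H₂ : Subgroup G)
    (hGass : ∀ g : G, Nat.card {h : G // h ∈ H₁ ∧ IsConj g h}
                    = Nat.card {h : G // h ∈ H₂ ∧ IsConj g h})
    (V : Type) [AddCommGroup V] [Module ℂ V] [FiniteDimensional ℂ V]
    (ρ : Representation ℂ G V) (φ : V →ₗ[ℂ] V)
    (hequiv : ∀ g : G, φ ∘ₗ ρ g = ρ g ∘ₗ φ)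
    (h₁ : ∀ v ∈ Representation.invariants (ρ.comp H₁.subtype : Representation ℂ H₁ V),
      φ v ∈ Representation.invariants (ρ.comp H₁.subtype : Representation ℂ H₁ V))
    (h₂ : ∀ v ∈ Representation.invariants (ρ.comp H₂.subtype : Representation ℂ H₂ V),
      φ v ∈ Representation.invariants (ρ.comp H₂.subtype : Representation ℂ H₂ V)) :
    LinearMap.charpoly (φ.restrict h₁) = LinearMap.charpoly (φ.restrict h₂) := by
  obtain ⟨e, he⟩ := gassmann_equiv H₁ H₂ hGass
  have le : ∀ μ : ℂ, ∀ g, Module.End.maxGenEigenspace φ μ ≤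
      (Module.End.maxGenEigenspace φ μ).comap (ρ g) := fun μ g x hx =>
    Module.End.mapsTo_maxGenEigenspace_of_comm (f := φ) (g := ρ g) (hequiv g) μ hx
  have roots : (LinearMap.charpoly (φ.restrict h₁)).roots =
      (LinearMap.charpoly (φ.restrict h₂)).roots := by
    classical
    ext μ
    rw [Polynomial.count_roots, Polynomial.count_roots,
      rootMultiplicity_restrict_invariants H₁ ρ φ μ (le μ) h₁,
      rootMultiplicity_restrict_invariants H₂ ρ φ μ (le μ) h₂]
    exact gassmann_finrank H₁ H₂ e he _
  rw [(IsAlgClosed.splits (LinearMap.charpoly (φ.restrict h₁))).eq_prod_roots_of_monic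
      (LinearMap.charpoly_monic _),
    (IsAlgClosed.splits (LinearMap.charpoly (φ.restrict h₂))).eq_prod_roots_of_monic
      (LinearMap.charpoly_monic _), roots]
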